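/- Suppose the matrix A together with γ̄ satisfies Assumption 2 and X(t) is generated by the algorithm X(t+1) = P_{γ̄}(A X(t)). Then the set of initial states X₀ ∈ S(n,d,γ̄) for which asymptotic consensus of directions (with point-wise convergence) occurs is an open subset of S(n,d,γ̄) (in the subspace topology inherited from ℝ^{n×d}). -/

import Mathlib

open Finset Filter Topology Matrix

noncomputable def euclNorm {d : ℕ} (x : Fin d → ℝ) : ℝ := Real.sqrt (∑ j, x j ^ 2)

def unitSphere (d : ℕ) : Set (Fin d → ℝ) := {x | euclNorm x = 1}

/-- A directional function on `S^{d-1}`: continuous and bounded above and below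
by positive constants on the unit sphere. -/
def IsDirectional {d : ℕ} (γ : (Fin d → ℝ) → ℝ) : Prop :=
  ContinuousOn γ (unitSphere d) ∧
    ∃ c C : ℝ, 0 < c ∧ ∀ x ∈ unitSphere d, c ≤ γ x ∧ γ x ≤ C

/-- The star boundary `S^{d-1}_γ = {γ(x) x : x ∈ S^{d-1}}`. -/
def starBoundary {d : ℕ} (γ : (Fin d → ℝ) → ℝ) : Set (Fin d → ℝ) :=
  {y | ∃ x ∈ unitSphere d, y = γ x • x}

/-- `S(n,d,γ̄)`: matrices whose `i`-th row lies on the star boundary of `γ_i`. -/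
def Sset (n d : ℕ) (γbar : Fin n → (Fin d → ℝ) → ℝ) : Set (Matrix (Fin n) (Fin d) ℝ) :=
  {X | ∀ i, X i ∈ starBoundary (γbar i)}

/-- Radial projection `P_γ(y) = γ(y/‖y‖₂) · y/‖y‖₂`. -/
noncomputable def radialProj {d : ℕ} (γ : (Fin d → ℝ) → ℝ) (y : Fin d → ℝ) : Fin d → ℝ :=
  γ ((euclNorm y)⁻¹ • y) • ((euclNorm y)⁻¹ • y)

/-- Row-wise radial projection. -/
noncomputable def rowProj {n d : ℕ} (γbar : Fin n → (Fin d → ℝ) → ℝ)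
    (B : Matrix (Fin n) (Fin d) ℝ) : Matrix (Fin n) (Fin d) ℝ :=
  Matrix.of fun i => radialProj (γbar i) (B i)

/-- Assumption 2: each `γ_i` is directional, `A` is a nonnegative weight matrix of a strongly
connected digraph, and the diagonal-dominance condition
`a_ii · min γ_i > Σ_{j≠i} a_ij · max γ_j` holds. -/
def Assumption2 {n d : ℕ} (A : Matrix (Fin n) (Fin n) ℝ)
    (γbar : Fin n → (Fin d → ℝ) → ℝ) : Prop :=
  (∀ i, IsDirectional (γbar i)) ∧
  (∃ E : Fin n → Fin n → Prop,
    (∀ i j, E i j → 0 < A i j) ∧ (∀ i j, ¬ E i j → A i j = 0) ∧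
    (∀ i j, Relation.ReflTransGen E i j)) ∧
  (∀ i, (∑ j ∈ Finset.univ.erase i, A i j * sSup (γbar j '' unitSphere d)) <
      A i i * sInf (γbar i '' unitSphere d))

/-- The trajectory of the algorithm `X(t+1) = P_γ̄(A X(t))`, indexed by `k = t - t₀`. -/
noncomputable def traj {n d : ℕ} (A : Matrix (Fin n) (Fin n) ℝ)
    (γbar : Fin n → (Fin d → ℝ) → ℝ) (X₀ : Matrix (Fin n) (Fin d) ℝ) :
    ℕ → Matrix (Fin n) (Fin d) ℝ
  | 0 => X₀
  | k + 1 => rowProj γbar (A * traj A γbar X₀ k)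

/-- `D_γ̄(B)`: diagonal matrix with entries `γ_i([B]_i/‖[B]_i‖₂)/‖[B]_i‖₂`. -/
noncomputable def Dmat {n d : ℕ} (γbar : Fin n → (Fin d → ℝ) → ℝ)
    (B : Matrix (Fin n) (Fin d) ℝ) : Matrix (Fin n) (Fin n) ℝ :=
  Matrix.diagonal fun i => γbar i ((euclNorm (B i))⁻¹ • B i) / euclNorm (B i)

/-- The product matrices `Ã(k,t₀,X₀) = D_γ̄(A X(t₀+k−1))A ⋯ D_γ̄(A X(t₀))A`. -/
noncomputable def Atilde {n d : ℕ} (A : Matrix (Fin n) (Fin n) ℝ)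
    (γbar : Fin n → (Fin d → ℝ) → ℝ) (X₀ : Matrix (Fin n) (Fin d) ℝ) :
    ℕ → Matrix (Fin n) (Fin n) ℝ
  | 0 => 1
  | k + 1 => Dmat γbar (A * traj A γbar X₀ k) * A * Atilde A γbar X₀ k

/-- `v` is the strictly positive unit vector to which all Euclidean-normalized rows of
`Ã(k,t₀,X₀)` converge. -/
def IsLimitVec {n d : ℕ} (A : Matrix (Fin n) (Fin n) ℝ)
    (γbar : Fin n → (Fin d → ℝ) → ℝ) (X₀ : Matrix (Fin n) (Fin d) ℝ)
    (v : Fin n → ℝ) : Prop :=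
  euclNorm v = 1 ∧ (∀ i, 0 < v i) ∧
    ∀ i, Tendsto (fun k => (euclNorm (Atilde A γbar X₀ k i))⁻¹ • Atilde A γbar X₀ k i)
      atTop (𝓝 v)

/-- Asymptotic consensus of directions. -/
def ConsensusDir {n d : ℕ} (X : ℕ → Matrix (Fin n) (Fin d) ℝ) : Prop :=
  ∀ i j, Tendsto
    (fun t => euclNorm ((euclNorm (X t i))⁻¹ • X t i - (euclNorm (X t j))⁻¹ • X t j))
    atTop (𝓝 0)

/-- Asymptotic consensus of directions with point-wise convergence to a unit vector. -/
def ConsensusPW {n d : ℕ} (X : ℕ → Matrix (Fin n) (Fin d) ℝ) : Prop :=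
  ∃ u : Fin d → ℝ, euclNorm u = 1 ∧
    ∀ i, Tendsto (fun t => (euclNorm (X t i))⁻¹ • X t i) atTop (𝓝 u)

section EuclNorm

variable {d : ℕ}

theorem euclNorm_eq_norm (x : Fin d → ℝ) : euclNorm x = ‖WithLp.toLp 2 x‖ := by
  simp [euclNorm, EuclideanSpace.norm_eq]

theorem euclNorm_nonneg (x : Fin d → ℝ) : 0 ≤ euclNorm x := Real.sqrt_nonneg _

theorem euclNorm_smul (c : ℝ) (x : Fin d → ℝ) : euclNorm (c • x) = |c| * euclNorm x := by
  simp [euclNorm_eq_norm, norm_smul]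

theorem euclNorm_sum_le {ι : Type*} (s : Finset ι) (f : ι → Fin d → ℝ) :
    euclNorm (∑ i ∈ s, f i) ≤ ∑ i ∈ s, euclNorm (f i) := by
  simp only [euclNorm_eq_norm, WithLp.toLp_sum]
  exact norm_sum_le _ _

theorem euclNorm_le_add (x y : Fin d → ℝ) : euclNorm x ≤ euclNorm (x + y) + euclNorm y := by
  simp only [euclNorm_eq_norm, WithLp.toLp_add]
  simpa using norm_sub_le (WithLp.toLp 2 x + WithLp.toLp 2 y) (WithLp.toLp 2 y)

theorem euclNorm_zero : euclNorm (0 : Fin d → ℝ) = 0 := by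
  simp [euclNorm]

theorem euclNorm_sq (x : Fin d → ℝ) : euclNorm x ^ 2 = x ⬝ᵥ x := by
  rw [euclNorm, Real.sq_sqrt (Finset.sum_nonneg fun _ _ => sq_nonneg _)]
  simp [dotProduct, sq]

theorem continuous_euclNorm : Continuous (euclNorm : (Fin d → ℝ) → ℝ) := by
  unfold euclNorm
  fun_prop

theorem abs_apply_le_euclNorm (x : Fin d → ℝ) (l : Fin d) : |x l| ≤ euclNorm x :=
  Real.abs_le_sqrt
    (Finset.single_le_sum (f := fun j => x j ^ 2) (fun _ _ => sq_nonneg _) (Finset.mem_univ l))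

theorem dotProduct_le_euclNorm_mul (x u : Fin d → ℝ) :
    x ⬝ᵥ u ≤ euclNorm x * ∑ l, |u l| := by
  rw [dotProduct, Finset.mul_sum]
  refine Finset.sum_le_sum fun l _ => ?_
  calc x l * u l ≤ |x l| * |u l| := by rw [← abs_mul]; exact le_abs_self _
    _ ≤ _ := by gcongr; exact abs_apply_le_euclNorm x l

theorem normalize_mem_unitSphere {x : Fin d → ℝ} (hx : 0 < euclNorm x) :
    (euclNorm x)⁻¹ • x ∈ unitSphere d := by
  simp only [unitSphere, Set.mem_ofPred_eq, euclNorm_smul, abs_inv, abs_of_pos hx]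
  exact inv_mul_cancel₀ hx.ne'

theorem normalize_smul {c : ℝ} (hc : 0 < c) (x : Fin d → ℝ) :
    (euclNorm (c • x))⁻¹ • (c • x) = (euclNorm x)⁻¹ • x := by
  rw [euclNorm_smul, abs_of_pos hc, smul_smul, mul_inv, mul_right_comm, inv_mul_cancel₀ hc.ne',
    one_mul]

theorem tendsto_normalize {ι : Type*} {l : Filter ι} {f : ι → Fin d → ℝ} {z : Fin d → ℝ}
    (hf : Tendsto f l (𝓝 z)) (hz : euclNorm z ≠ 0) :
    Tendsto (fun t => (euclNorm (f t))⁻¹ • f t) l (𝓝 ((euclNorm z)⁻¹ • z)) :=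
  (((continuous_euclNorm.tendsto z).comp hf).inv₀ hz).smul hf

end EuclNorm

section Averaging

/-- Repeated averaging over a fixed strongly connected graph with self-loops and weights bounded
below drives all values to a common limit. -/
theorem exists_tendsto_of_averaging {ι : Type*} [Fintype ι] [DecidableEq ι] [Nonempty ι]
    {E : ι → ι → Prop} (hconn : ∀ i j, Relation.ReflTransGen E i j)
    {b : ι → ι → ℝ} (hbE : ∀ i j, E i j → 0 < b i j) (hbd : ∀ i, 0 < b i i)
    {w : ℕ → ι → ι → ℝ} (hw0 : ∀ t i j, 0 ≤ w t i j) (hw1 : ∀ t i, ∑ j, w t i j = 1)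
    (hbw : ∀ t i j, b i j ≤ w t i j)
    {f : ℕ → ι → ℝ} (hf : ∀ t i, f (t + 1) i = ∑ j, w t i j * f t j) :
    ∃ c, ∀ i, Tendsto (fun t => f t i) atTop (𝓝 c) := by
  have upper_step : ∀ t M, (∀ l, f t l ≤ M) → ∀ l, f (t + 1) l ≤ M := by
    intro t M h l
    rw [hf]
    calc ∑ j, w t l j * f t j ≤ ∑ j, w t l j * M :=
          Finset.sum_le_sum fun j _ => mul_le_mul_of_nonneg_left (h j) (hw0 t l j)
      _ = M := by rw [← Finset.sum_mul, hw1, one_mul]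
  have lower_step : ∀ t m, (∀ l, m ≤ f t l) → ∀ l, m ≤ f (t + 1) l := by
    intro t m h l
    rw [hf]
    calc m = ∑ j, w t l j * m := by rw [← Finset.sum_mul, hw1, one_mul]
      _ ≤ ∑ j, w t l j * f t j :=
          Finset.sum_le_sum fun j _ => mul_le_mul_of_nonneg_left (h j) (hw0 t l j)
  have upper : ∀ k t M, (∀ l, f t l ≤ M) → ∀ l, f (t + k) l ≤ M := by
    intro k
    induction k with
    | zero => exact fun t M h => h
    | succ k ih => exact fun t M h => upper_step _ _ (ih t M h)
  let P : ℕ → ι → ι → Prop := fun k i j =>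
    ∃ δ > 0, ∀ t M, (∀ l, f t l ≤ M) → f (t + k) i ≤ M - δ * (M - f t j)
  have prepend : ∀ k i i' j, 0 < b i i' → P k i' j → P (k + 1) i j := by
    rintro k i i' j hb ⟨δ, hδ, h⟩
    refine ⟨b i i' * δ, mul_pos hb hδ, fun t M hM => ?_⟩
    have h1 := h t M hM
    have h2 := upper k t M hM
    have h3 : w (t + k) i i' * (M - f (t + k) i') ≤
        ∑ l, w (t + k) i l * (M - f (t + k) l) :=
      Finset.single_le_sum (f := fun l => w (t + k) i l * (M - f (t + k) l))
        (fun l _ => mul_nonneg (hw0 _ _ _) (sub_nonneg.2 (h2 l))) (Finset.mem_univ i')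
    simp only [mul_sub, Finset.sum_sub_distrib] at h3
    rw [← hf, ← Finset.sum_mul, hw1] at h3
    have h4 : b i i' * (δ * (M - f t j)) ≤ w (t + k) i i' * (M - f (t + k) i') :=
      mul_le_mul (hbw _ _ _) (by linarith) (mul_nonneg hδ.le (sub_nonneg.2 (hM j))) (hw0 _ _ _)
    rw [← add_assoc]
    linarith
  have reach : ∀ i j, ∃ k, P k i j := by
    intro i j
    induction hconn i j using Relation.ReflTransGen.head_induction_on with
    | refl => exact ⟨0, 1, one_pos, fun t M _ => by simp⟩
    | head h _ ih =>
      obtain ⟨k, hk⟩ := ih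
      exact ⟨k + 1, prepend _ _ _ _ (hbE _ _ h) hk⟩
  choose k hk using reach
  have mono : ∀ i j p q, P p i j → P (p + q) i j := by
    intro i j p q hp
    induction q with
    | zero => exact hp
    | succ q ih => exact prepend _ _ _ _ (hbd i) ih
  obtain ⟨p₀, hp₀⟩ := Finite.exists_max fun p : ι × ι => k p.1 p.2
  set L := k p₀.1 p₀.2
  have hL : ∀ i j, P L i j := fun i j => by
    simpa [Nat.add_sub_of_le (hp₀ (i, j))] using mono i j _ (L - k i j) (hk i j)
  choose δ hδ hδL using hL
  obtain ⟨q₀, hq₀⟩ := Finite.exists_min fun p : ι × ι => δ p.1 p.2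
  let M : ℕ → ℝ := fun t => ⨆ i, f t i
  let m : ℕ → ℝ := fun t => ⨅ i, f t i
  have le_M : ∀ t i, f t i ≤ M t := fun t i => le_ciSup (Finite.bddAbove_range (f t)) i
  have m_le : ∀ t i, m t ≤ f t i := fun t i => ciInf_le (Finite.bddBelow_range (f t)) i
  have M_anti : Antitone M :=
    antitone_nat_of_succ_le fun t => ciSup_le (upper_step t _ (le_M t))
  have m_mono : Monotone m :=
    monotone_nat_of_le_succ fun t => le_ciInf (lower_step t _ (m_le t))
  have m_le_M : ∀ t, m t ≤ M t := fun t =>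
    (m_le t (Classical.arbitrary ι)).trans (le_M t _)
  have contract : ∀ t, M (t + L) ≤ M t - δ q₀.1 q₀.2 * (M t - m t) := by
    intro t
    obtain ⟨j, hj⟩ := exists_eq_ciInf_of_finite (f := f t)
    refine ciSup_le fun i => (hδL i j t (M t) (le_M t)).trans ?_
    rw [hj]
    exact sub_le_sub_left (mul_le_mul_of_nonneg_right (hq₀ (i, j)) (sub_nonneg.2 (m_le_M t))) _
  have hM := tendsto_atTop_ciInf M_anti
    ⟨m 0, by rintro _ ⟨t, rfl⟩; exact (m_mono (Nat.zero_le t)).trans (m_le_M t)⟩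
  have hm := tendsto_atTop_ciSup m_mono
    ⟨M 0, by rintro _ ⟨t, rfl⟩; exact (m_le_M t).trans (M_anti (Nat.zero_le t))⟩
  set M' := ⨅ t, M t
  set m' := ⨆ t, m t
  have h1 : M' ≤ M' - δ q₀.1 q₀.2 * (M' - m') :=
    le_of_tendsto_of_tendsto' ((tendsto_add_atTop_iff_nat L).2 hM)
      (hM.sub ((hM.sub hm).const_mul _)) contract
  have h2 : m' ≤ M' := le_of_tendsto_of_tendsto' hm hM m_le_M
  have h3 : m' = M' := by
    have := nonpos_of_mul_nonpos_right (by linarith : δ q₀.1 q₀.2 * (M' - m') ≤ 0) (hδ _ _)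
    linarith
  exact ⟨M', fun i => tendsto_of_tendsto_of_tendsto_of_le_of_le (h3 ▸ hm) hM
    (fun t => m_le t i) (fun t => le_M t i)⟩

end Averaging

section Dynamics

variable {n d : ℕ} {A : Matrix (Fin n) (Fin n) ℝ} {γbar : Fin n → (Fin d → ℝ) → ℝ}

theorem IsDirectional.pos {γ : (Fin d → ℝ) → ℝ} (hγ : IsDirectional γ) {x : Fin d → ℝ}
    (hx : x ∈ unitSphere d) : 0 < γ x := by
  obtain ⟨-, c, C, hc, h⟩ := hγ
  exact hc.trans_le (h x hx).1

theorem exists_euclNorm_eq_of_mem_starBoundary {γ : (Fin d → ℝ) → ℝ} (hγ : IsDirectional γ)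
    {y : Fin d → ℝ} (hy : y ∈ starBoundary γ) : ∃ x ∈ unitSphere d, euclNorm y = γ x := by
  obtain ⟨x, hx, rfl⟩ := hy
  refine ⟨x, hx, ?_⟩
  rw [euclNorm_smul, abs_of_pos (hγ.pos hx), show euclNorm x = 1 from hx, mul_one]

theorem IsDirectional.euclNorm_le_sSup {γ : (Fin d → ℝ) → ℝ} (hγ : IsDirectional γ)
    {y : Fin d → ℝ} (hy : y ∈ starBoundary γ) : euclNorm y ≤ sSup (γ '' unitSphere d) := by
  obtain ⟨x, hx, h⟩ := exists_euclNorm_eq_of_mem_starBoundary hγ hy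
  obtain ⟨-, c, C, hc, hb⟩ := hγ
  rw [h]
  exact le_csSup ⟨C, by rintro _ ⟨z, hz, rfl⟩; exact (hb z hz).2⟩ ⟨x, hx, rfl⟩

theorem IsDirectional.sInf_le_euclNorm {γ : (Fin d → ℝ) → ℝ} (hγ : IsDirectional γ)
    {y : Fin d → ℝ} (hy : y ∈ starBoundary γ) : sInf (γ '' unitSphere d) ≤ euclNorm y := by
  obtain ⟨x, hx, h⟩ := exists_euclNorm_eq_of_mem_starBoundary hγ hy
  obtain ⟨-, c, C, hc, hb⟩ := hγ
  rw [h]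
  exact csInf_le ⟨c, by rintro _ ⟨z, hz, rfl⟩; exact (hb z hz).1⟩ ⟨x, hx, rfl⟩

theorem Assumption2.nonneg (hA : Assumption2 A γbar) (i j : Fin n) : 0 ≤ A i j := by
  obtain ⟨-, ⟨E, hE, hE', -⟩, -⟩ := hA
  by_cases h : E i j
  · exact (hE i j h).le
  · exact (hE' i j h).ge

theorem Assumption2.diag_pos (hA : Assumption2 A γbar) (i : Fin n) : 0 < A i i := by
  refine (hA.nonneg i i).lt_of_ne' fun h => ?_
  have h1 := hA.2.2 i
  rw [h, zero_mul] at h1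
  refine h1.not_ge (Finset.sum_nonneg fun j _ => mul_nonneg (hA.nonneg i j) ?_)
  refine Real.sSup_nonneg ?_
  rintro _ ⟨x, hx, rfl⟩
  exact ((hA.1 j).pos hx).le

theorem mul_row_eq_sum (A : Matrix (Fin n) (Fin n) ℝ) (X : Matrix (Fin n) (Fin d) ℝ)
    (i : Fin n) : (A * X) i = ∑ j, A i j • X j := by
  ext l
  simp [Matrix.mul_apply, Finset.sum_apply]

theorem Assumption2.euclNorm_mul_row_pos (hA : Assumption2 A γbar)
    {X : Matrix (Fin n) (Fin d) ℝ} (hX : X ∈ Sset n d γbar) (i : Fin n) :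
    0 < euclNorm ((A * X) i) := by
  have h1 := hA.2.2 i
  have h2 := euclNorm_le_add (A i i • X i) (∑ j ∈ Finset.univ.erase i, A i j • X j)
  rw [Finset.add_sum_erase _ (fun j => A i j • X j) (Finset.mem_univ i), ← mul_row_eq_sum,
    euclNorm_smul, abs_of_nonneg (hA.nonneg i i)] at h2
  have h3 : euclNorm (∑ j ∈ Finset.univ.erase i, A i j • X j) ≤
      ∑ j ∈ Finset.univ.erase i, A i j * sSup (γbar j '' unitSphere d) := by
    refine (euclNorm_sum_le _ _).trans (Finset.sum_le_sum fun j _ => ?_)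
    rw [euclNorm_smul, abs_of_nonneg (hA.nonneg i j)]
    exact mul_le_mul_of_nonneg_left ((hA.1 j).euclNorm_le_sSup (hX j)) (hA.nonneg i j)
  have h4 := mul_le_mul_of_nonneg_left ((hA.1 i).sInf_le_euclNorm (hX i)) (hA.nonneg i i)
  linarith

theorem Assumption2.rowProj_mem (hA : Assumption2 A γbar)
    {X : Matrix (Fin n) (Fin d) ℝ} (hX : X ∈ Sset n d γbar) :
    rowProj γbar (A * X) ∈ Sset n d γbar := fun i =>
  ⟨_, normalize_mem_unitSphere (hA.euclNorm_mul_row_pos hX i), rfl⟩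

theorem Assumption2.traj_mem (hA : Assumption2 A γbar)
    {X : Matrix (Fin n) (Fin d) ℝ} (hX : X ∈ Sset n d γbar) (k : ℕ) :
    traj A γbar X k ∈ Sset n d γbar := by
  induction k with
  | zero => exact hX
  | succ k ih => exact hA.rowProj_mem ih

theorem continuousOn_radialProj {γ : (Fin d → ℝ) → ℝ} (hγ : IsDirectional γ) :
    ContinuousOn (radialProj γ) {y | 0 < euclNorm y} := by
  have h : ContinuousOn (fun y : Fin d → ℝ => (euclNorm y)⁻¹ • y) {y | 0 < euclNorm y} :=
    (continuous_euclNorm.continuousOn.inv₀ fun y hy => ne_of_gt hy).smul continuousOn_id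
  exact (hγ.1.comp h fun y hy => normalize_mem_unitSphere hy).smul h

theorem Assumption2.continuousOn_traj (hA : Assumption2 A γbar) (k : ℕ) :
    ContinuousOn (fun X => traj A γbar X k) (Sset n d γbar) := by
  induction k with
  | zero => exact continuousOn_id
  | succ k ih =>
    refine continuousOn_pi.2 fun i => ?_
    have h : ContinuousOn (fun X => (A * traj A γbar X k) i) (Sset n d γbar) :=
      (continuous_apply i).comp_continuousOn
        ((continuous_const.matrix_mul continuous_id).comp_continuousOn ih)
    exact (continuousOn_radialProj (hA.1 i)).comp h
      fun X hX => hA.euclNorm_mul_row_pos (hA.traj_mem hX k) i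

/-- If all rows lie in a common open half-space, their directions converge to a common limit. -/
theorem Assumption2.consensusPW_of_halfSpace (hA : Assumption2 A γbar) (hn : 1 ≤ n)
    {X : ℕ → Matrix (Fin n) (Fin d) ℝ} (hXS : ∀ t, X t ∈ Sset n d γbar)
    (hX : ∀ t, X (t + 1) = rowProj γbar (A * X t)) {u : Fin d → ℝ}
    (hu : ∀ i, 0 < X 0 i ⬝ᵥ u) : ConsensusPW X := by
  have : Nonempty (Fin n) := ⟨⟨0, hn⟩⟩
  have hAnn := hA.nonneg
  have bounds : ∀ i, ∃ c C : ℝ, 0 < c ∧ ∀ t, c ≤ euclNorm (X t i) ∧ euclNorm (X t i) ≤ C := by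
    intro i
    obtain ⟨-, c, C, hc, hb⟩ := hA.1 i
    refine ⟨c, C, hc, fun t => ?_⟩
    obtain ⟨x, hx, h⟩ := exists_euclNorm_eq_of_mem_starBoundary (hA.1 i) (hXS t i)
    rw [h]
    exact hb x hx
  choose c C hc hcC using bounds
  have scale : ∀ t i, ∃ r : ℝ, 0 < r ∧ X (t + 1) i = r • ∑ j, A i j • X t j := by
    intro t i
    have hpos := hA.euclNorm_mul_row_pos (hXS t) i
    refine ⟨γbar i ((euclNorm ((A * X t) i))⁻¹ • (A * X t) i) * (euclNorm ((A * X t) i))⁻¹,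
      mul_pos ((hA.1 i).pos (normalize_mem_unitSphere hpos)) (inv_pos.2 hpos), ?_⟩
    rw [hX, mul_smul, ← mul_row_eq_sum]
    rfl
  choose r hr hrX using scale
  let h : ℕ → Fin n → ℝ := fun t i => X t i ⬝ᵥ u
  have h_succ : ∀ t i, h (t + 1) i = r t i * ∑ j, A i j * h t j := by
    intro t i
    simp only [h, hrX, smul_dotProduct, sum_dotProduct, smul_eq_mul]
  obtain ⟨ε, hε, hε0⟩ : ∃ ε > 0, ∀ i, ε * euclNorm (X 0 i) ≤ h 0 i := by
    obtain ⟨i₀, hi₀⟩ := Finite.exists_min fun i => h 0 i / euclNorm (X 0 i)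
    have hN : ∀ i, 0 < euclNorm (X 0 i) := fun i => (hc i).trans_le (hcC i 0).1
    exact ⟨_, div_pos (hu i₀) (hN i₀), fun i => (le_div_iff₀ (hN i)).1 (hi₀ i)⟩
  have cone : ∀ t i, ε * euclNorm (X t i) ≤ h t i := by
    intro t
    induction t with
    | zero => exact hε0
    | succ t ih =>
      intro i
      rw [h_succ, hrX, euclNorm_smul, abs_of_pos (hr t i), mul_left_comm]
      refine mul_le_mul_of_nonneg_left ?_ (hr t i).le
      refine (mul_le_mul_of_nonneg_left (euclNorm_sum_le _ _) hε.le).trans ?_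
      rw [Finset.mul_sum]
      refine Finset.sum_le_sum fun j _ => ?_
      rw [euclNorm_smul, abs_of_nonneg (hAnn i j), mul_left_comm]
      exact mul_le_mul_of_nonneg_left (ih j) (hAnn i j)
  have h_lower : ∀ t i, ε * c i ≤ h t i := fun t i =>
    (mul_le_mul_of_nonneg_left (hcC i t).1 hε.le).trans (cone t i)
  have h_pos : ∀ t i, 0 < h t i := fun t i => (mul_pos hε (hc i)).trans_le (h_lower t i)
  let B : Fin n → ℝ := fun i => C i * ∑ l, |u l|
  have h_upper : ∀ t i, h t i ≤ B i := fun t i =>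
    (dotProduct_le_euclNorm_mul _ _).trans
      (mul_le_mul_of_nonneg_right (hcC i t).2 (Finset.sum_nonneg fun _ _ => abs_nonneg _))
  let S : ℕ → Fin n → ℝ := fun t i => ∑ j, A i j * h t j
  have S_pos : ∀ t i, 0 < S t i := fun t i =>
    Finset.sum_pos' (fun j _ => mul_nonneg (hAnn i j) (h_pos t j).le)
      ⟨i, Finset.mem_univ i, mul_pos (hA.diag_pos i) (h_pos t i)⟩
  have S_le : ∀ t i, S t i ≤ ∑ j, A i j * B j := fun t i =>
    Finset.sum_le_sum fun j _ => mul_le_mul_of_nonneg_left (h_upper t j) (hAnn i j)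
  have D_pos : ∀ i, 0 < ∑ j, A i j * B j := fun i => (S_pos 0 i).trans_le (S_le 0 i)
  obtain ⟨E, hE, -, hconn⟩ := hA.2.1
  have coord : ∀ l, ∃ z, ∀ i, Tendsto (fun t => X t i l / h t i) atTop (𝓝 z) := by
    intro l
    refine exists_tendsto_of_averaging hconn
      (b := fun i j => A i j * (ε * c j) / ∑ j, A i j * B j)
      (w := fun t i j => A i j * h t j / S t i) ?_ ?_ ?_ ?_ ?_ ?_
    · exact fun i j hij => div_pos (mul_pos (hE i j hij) (mul_pos hε (hc j))) (D_pos i)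
    · exact fun i => div_pos (mul_pos (hA.diag_pos i) (mul_pos hε (hc i))) (D_pos i)
    · exact fun t i j => div_nonneg (mul_nonneg (hAnn i j) (h_pos t j).le) (S_pos t i).le
    · intro t i
      rw [← Finset.sum_div]
      exact div_self (S_pos t i).ne'
    · exact fun t i j => div_le_div₀ (mul_nonneg (hAnn i j) (h_pos t j).le)
        (mul_le_mul_of_nonneg_left (h_lower t j) (hAnn i j)) (S_pos t i) (S_le t i)
    · intro t i
      have e : X (t + 1) i l = r t i * ∑ j, A i j * X t j l := by
        simp [hrX, Finset.sum_apply]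
      rw [e, h_succ, mul_div_mul_left _ _ (hr t i).ne', Finset.sum_div]
      refine Finset.sum_congr rfl fun j _ => ?_
      have := (h_pos t j).ne'
      change _ / S t i = _
      field_simp
  choose z hz using coord
  have hz' : ∀ i, Tendsto (fun t => (h t i)⁻¹ • X t i) atTop (𝓝 z) := fun i =>
    tendsto_pi_nhds.2 fun l => (hz l i).congr fun t => by
      simp [div_eq_inv_mul]
  have hz_dot : z ⬝ᵥ u = 1 := by
    have hcont : Continuous fun x : Fin d → ℝ => x ⬝ᵥ u := by
      unfold dotProduct
      fun_prop
    refine tendsto_nhds_unique ((hcont.tendsto z).comp (hz' ⟨0, hn⟩))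
      (tendsto_const_nhds.congr fun t => ?_)
    simp only [Function.comp_apply, smul_dotProduct, smul_eq_mul]
    exact (inv_mul_cancel₀ (h_pos t _).ne').symm
  have hz_norm : 0 < euclNorm z := by
    refine (euclNorm_nonneg z).lt_of_ne' fun h0 => ?_
    have := dotProduct_le_euclNorm_mul z u
    rw [h0, hz_dot] at this
    linarith
  refine ⟨_, normalize_mem_unitSphere hz_norm, fun i => ?_⟩
  exact (tendsto_normalize (hz' i) hz_norm.ne').congr fun t =>
    normalize_smul (inv_pos.2 (h_pos t i)) _

theorem ConsensusPW.consensusDir {X : ℕ → Matrix (Fin n) (Fin d) ℝ} (hX : ConsensusPW X) :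
    ConsensusDir X := by
  obtain ⟨u, -, hu⟩ := hX
  intro i j
  have h := (continuous_euclNorm.tendsto (u - u)).comp ((hu i).sub (hu j))
  rw [sub_self, euclNorm_zero] at h
  exact h

theorem ConsensusPW.exists_halfSpace {X : ℕ → Matrix (Fin n) (Fin d) ℝ} (hX : ConsensusPW X) :
    ∃ k, ∃ u : Fin d → ℝ, ∀ i, 0 < X k i ⬝ᵥ u := by
  obtain ⟨u, hu1, hu⟩ := hX
  have hcont : Continuous fun x : Fin d → ℝ => x ⬝ᵥ u := by
    unfold dotProduct
    fun_prop
  have huu : 0 < u ⬝ᵥ u := by rw [← euclNorm_sq, hu1]; norm_num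
  have hev : ∀ i, ∀ᶠ t in atTop, 0 < ((euclNorm (X t i))⁻¹ • X t i) ⬝ᵥ u := fun i =>
    ((hcont.tendsto u).comp (hu i)).eventually (lt_mem_nhds huu)
  obtain ⟨k, hk⟩ := (eventually_all.2 hev).exists
  refine ⟨k, u, fun i => ?_⟩
  have := hk i
  rw [smul_dotProduct, smul_eq_mul] at this
  exact pos_of_mul_pos_right this (inv_nonneg.2 (euclNorm_nonneg _))

theorem ConsensusPW.of_shift {X : ℕ → Matrix (Fin n) (Fin d) ℝ} (k : ℕ)
    (hX : ConsensusPW fun t => X (t + k)) : ConsensusPW X := by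
  obtain ⟨u, hu1, hu⟩ := hX
  exact ⟨u, hu1, fun i => (tendsto_add_atTop_iff_nat
    (f := fun t => (euclNorm (X t i))⁻¹ • X t i) k).1 (hu i)⟩

theorem isOpen_setOf_halfSpace :
    IsOpen {X : Matrix (Fin n) (Fin d) ℝ | ∃ u : Fin d → ℝ, ∀ i, 0 < X i ⬝ᵥ u} := by
  simp only [Set.ofPred_exists, Set.ofPred_forall]
  refine isOpen_iUnion fun u => isOpen_iInter_of_finite fun i => ?_
  refine isOpen_lt continuous_const ?_
  unfold dotProduct
  exact continuous_finsetSum _ fun l _ => (continuous_id.matrix_elem i l).mul continuous_const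

end Dynamics

theorem stmt14 {n d : ℕ} (hn : 1 ≤ n) (hd : 1 ≤ d)
    (A : Matrix (Fin n) (Fin n) ℝ) (γbar : Fin n → (Fin d → ℝ) → ℝ)
    (hA : Assumption2 A γbar) :
    ∃ U : Set (Matrix (Fin n) (Fin d) ℝ), IsOpen U ∧
      {X₀ | X₀ ∈ Sset n d γbar ∧ ConsensusDir (traj A γbar X₀) ∧
        ConsensusPW (traj A γbar X₀)} = Sset n d γbar ∩ U := by
  choose U hU hUeq using fun k =>
    continuousOn_iff'.1 (hA.continuousOn_traj k) _ isOpen_setOf_halfSpace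
  refine ⟨⋃ k, U k, isOpen_iUnion hU, ?_⟩
  ext X₀
  simp only [Set.mem_ofPred_eq, Set.mem_inter_iff, Set.mem_iUnion]
  refine and_congr_right fun hX₀ => ?_
  have mem_iff : ∀ k, X₀ ∈ U k ↔ ∃ u : Fin d → ℝ, ∀ i, 0 < traj A γbar X₀ k i ⬝ᵥ u := by
    intro k
    have := Set.ext_iff.1 (hUeq k) X₀
    simpa [hX₀] using this.symm
  simp only [mem_iff]
  constructor
  · exact fun h => h.2.exists_halfSpace
  · rintro ⟨k, u, hu⟩
    have h : ConsensusPW (traj A γbar X₀) := .of_shift k <|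
      hA.consensusPW_of_halfSpace hn (fun t => hA.traj_mem hX₀ _)
        (fun t => by rw [Nat.add_right_comm]; rfl) (u := u) (by simpa using hu)
    exact ⟨h.consensusDir, h⟩
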